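/- arXiv:1605.02915 — 2 statements merged into one kernel-verified Lean document; each statement's English description precedes it below -/
import Mathlib

section
/- Let τ lie in the upper half-plane, p^λ=e^{iπτλ}, and ω=e^{2πi/3}. Let f(x) be any one of the three functions x^{−1}θ(x²,px²,−px²;p²), x^{−2}θ(x²,−x²,px²;p²), x^{−2}θ(x²,−x²,−px²;p²). Then for all x∈ℂ∖{0}: (i) f(ω^{−1}x)+f(x)+f(ωx)=0, and (ii) x^{−4}f(p^{−2/3}x)+p^{−4/3}f(x)+x⁴f(p^{2/3}x)=0. -/
open Complex BigOperators Finset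

noncomputable section

def qpoch (a p : ℂ) : ℂ := ∏' j : ℕ, (1 - a * p ^ j)

def theta (x p : ℂ) : ℂ := qpoch x p * qpoch (p / x) p

def pPow (τ lam : ℂ) : ℂ := Complex.exp (Real.pi * Complex.I * τ * lam)

def omg : ℂ := Complex.exp (2 * Real.pi * Complex.I / 3)

/-- Integral over the unit circle with respect to the angle. -/
def angleIntegral (G : ℂ → ℂ) : ℂ := ∫ t in (0 : ℝ)..2 * Real.pi, G (exp (t * I))

/-- The `n`-th Laurent coefficient at `0`, up to the factor `2π`. -/
def laurentIntegral (F : ℂ → ℂ) (n : ℤ) : ℂ := angleIntegral fun z ↦ z ^ (-n) * F z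

lemma angleIntegral_comp_mul {G : ℂ → ℂ} (hG : ∀ z ≠ 0, DifferentiableAt ℂ G z) {c : ℂ}
    (hc : c ≠ 0) : angleIntegral (fun z ↦ G (c * z)) = angleIntegral G := by
  have radius : ∀ r R : ℝ, 0 < r → r ≤ R →
      angleIntegral (fun z ↦ G (R * z)) = angleIntegral (fun z ↦ G (r * z)) := by
    intro r R hr hrR
    have key := circleIntegral_sub_center_inv_smul_eq_of_differentiable_on_annulus_off_countable
      (c := 0) hr hrR Set.countable_empty (f := G)
      (fun z hz ↦ (hG z (by
        rintro rfl; simp only [Set.mem_sdiff, Metric.mem_ball, dist_self] at hz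
        exact hz.2 hr)).continuousAt.continuousWithinAt)
      (fun z hz ↦ hG z (by
        rintro rfl; simp only [Set.mem_sdiff, Metric.mem_closedBall, dist_self] at hz
        exact hz.1.2 hr.le))
    have unfold_circle : ∀ S : ℝ, 0 < S → (∮ z in C(0, S), (z - 0)⁻¹ • G z) =
        I * angleIntegral (fun z ↦ G (S * z)) := by
      intro S hS
      have hS' : (S : ℂ) ≠ 0 := by exact_mod_cast hS.ne'
      rw [circleIntegral, angleIntegral, ← intervalIntegral.integral_const_mul]
      refine intervalIntegral.integral_congr fun t _ ↦ ?_
      simp only [deriv_circleMap, circleMap, sub_zero, zero_add, smul_eq_mul]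
      field_simp [exp_ne_zero]
    rw [unfold_circle R (hr.trans_le hrR), unfold_circle r hr] at key
    exact mul_left_cancel₀ I_ne_zero key
  have rotation : angleIntegral (fun z ↦ G (c * z)) = angleIntegral (fun z ↦ G (‖c‖ * z)) := by
    have hper : Function.Periodic (fun t : ℝ ↦ G (‖c‖ * exp (t * I))) (2 * Real.pi) := by
      intro t
      have : exp (((t + 2 * Real.pi : ℝ) : ℂ) * I) = exp (t * I) := 
        (congrArg exp (by push_cast; ring)).trans (exp_periodic _)
      simp only [this]
    have h := hper.intervalIntegral_add_eq (arg c) 0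
    rw [zero_add] at h
    simp only [angleIntegral]
    rw [← h]
    have h2 := intervalIntegral.integral_comp_add_right
      (f := fun t : ℝ ↦ G (‖c‖ * exp (t * I))) (a := 0) (b := 2 * Real.pi) (arg c)
    rw [zero_add, add_comm (2 * Real.pi)] at h2
    rw [← h2]
    refine intervalIntegral.integral_congr fun t _ ↦ ?_
    congr 1
    conv_lhs => rw [← norm_mul_exp_arg_mul_I c]
    rw [mul_assoc, ← exp_add]
    push_cast
    ring_nf
  have hc0 : 0 < ‖c‖ := norm_pos_iff.mpr hc
  rw [rotation]
  have h1 : angleIntegral G = angleIntegral (fun z ↦ G ((1 : ℝ) * z)) := by simp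
  rw [h1]
  rcases le_total ‖c‖ 1 with h | h
  · exact (radius _ _ hc0 h).symm
  · exact radius _ _ one_pos h

lemma angleIntegral_comp_inv (G : ℂ → ℂ) :
    angleIntegral (fun z ↦ G z⁻¹) = angleIntegral G := by
  have hper : Function.Periodic (fun t : ℝ ↦ G (exp (t * I))) (2 * Real.pi) := by
    intro t
    have : exp (((t + 2 * Real.pi : ℝ) : ℂ) * I) = exp (t * I) := 
      (congrArg exp (by push_cast; ring)).trans (exp_periodic _)
    simp only [this]
  have h := hper.intervalIntegral_add_eq (-(2 * Real.pi)) 0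
  have h2 := intervalIntegral.integral_comp_neg
    (f := fun t : ℝ ↦ G (exp (t * I))) (a := 0) (b := 2 * Real.pi)
  rw [neg_add_cancel, zero_add] at h
  rw [neg_zero, h] at h2
  rw [angleIntegral, angleIntegral, ← h2]
  refine intervalIntegral.integral_congr fun t _ ↦ ?_
  simp only [← exp_neg]
  push_cast
  ring_nf

lemma laurentIntegral_congr {F G : ℂ → ℂ} (h : ∀ z ≠ 0, F z = G z) (n : ℤ) :
    laurentIntegral F n = laurentIntegral G n :=
  intervalIntegral.integral_congr fun t _ ↦ by simp only [h _ (exp_ne_zero _)]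

lemma laurentIntegral_add {F G : ℂ → ℂ} (hF : ∀ z ≠ 0, DifferentiableAt ℂ F z)
    (hG : ∀ z ≠ 0, DifferentiableAt ℂ G z) (n : ℤ) :
    laurentIntegral (fun z ↦ F z + G z) n = laurentIntegral F n + laurentIntegral G n := by
  have integrable : ∀ H : ℂ → ℂ, (∀ z ≠ 0, DifferentiableAt ℂ H z) → IntervalIntegrable
      (fun t : ℝ ↦ exp (t * I) ^ (-n) * H (exp (t * I))) MeasureTheory.volume 0
      (2 * Real.pi) := by
    intro H hH
    refine Continuous.intervalIntegrable (continuous_iff_continuousAt.mpr fun t ↦ ?_) _ _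
    have he : ContinuousAt (fun t : ℝ ↦ exp (t * I)) t := by fun_prop
    exact (he.zpow₀ _ (Or.inl (exp_ne_zero _))).mul
      (ContinuousAt.comp (f := fun t : ℝ ↦ exp (t * I)) (hH _ (exp_ne_zero _)).continuousAt he)
  rw [laurentIntegral, laurentIntegral, laurentIntegral, angleIntegral, angleIntegral,
    angleIntegral, ← intervalIntegral.integral_add (integrable F hF) (integrable G hG)]
  simp only [mul_add]

lemma laurentIntegral_const_mul (c : ℂ) (F : ℂ → ℂ) (n : ℤ) :
    laurentIntegral (fun z ↦ c * F z) n = c * laurentIntegral F n := by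
  rw [laurentIntegral, laurentIntegral, angleIntegral, angleIntegral,
    ← intervalIntegral.integral_const_mul]
  exact intervalIntegral.integral_congr fun t _ ↦ by ring

lemma laurentIntegral_zpow_mul (k : ℤ) (F : ℂ → ℂ) (n : ℤ) :
    laurentIntegral (fun z ↦ z ^ k * F z) n = laurentIntegral F (n - k) := by
  refine intervalIntegral.integral_congr fun t _ ↦ ?_
  simp only
  rw [← mul_assoc, ← zpow_add₀ (exp_ne_zero _)]
  ring_nf

lemma laurentIntegral_comp_mul {F : ℂ → ℂ} (hF : ∀ z ≠ 0, DifferentiableAt ℂ F z) {c : ℂ}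
    (hc : c ≠ 0) (n : ℤ) :
    laurentIntegral (fun z ↦ F (c * z)) n = c ^ n * laurentIntegral F n := by
  have h := angleIntegral_comp_mul (G := fun z ↦ z ^ (-n) * F z)
    (fun z hz ↦ (differentiableAt_zpow.mpr (Or.inl hz)).mul (hF z hz)) hc
  rw [laurentIntegral, laurentIntegral, ← h, angleIntegral, angleIntegral,
    ← intervalIntegral.integral_const_mul]
  refine intervalIntegral.integral_congr fun t _ ↦ ?_
  rw [mul_zpow, zpow_neg c]
  field_simp

lemma laurentIntegral_comp_inv (F : ℂ → ℂ) (n : ℤ) :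
    laurentIntegral (fun z ↦ F z⁻¹) n = laurentIntegral F (-n) := by
  rw [laurentIntegral, laurentIntegral, ← angleIntegral_comp_inv]
  simp

lemma eq_zero_of_laurentIntegral_eq_zero {F : ℂ → ℂ} (hF : ∀ z ≠ 0, DifferentiableAt ℂ F z)
    (h : ∀ n, laurentIntegral F n = 0) {x : ℂ} (hx : x ≠ 0) : F x = 0 := by
  have : Fact (0 < 2 * Real.pi) := ⟨Real.two_pi_pos⟩
  let g : C(AddCircle (2 * Real.pi), ℂ) :=
    ⟨fun t ↦ F (x * (AddCircle.toCircle t : ℂ)), by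
      refine continuous_iff_continuousAt.mpr fun t ↦ ?_
      have hne : x * (AddCircle.toCircle t : ℂ) ≠ 0 := mul_ne_zero hx (Circle.coe_ne_zero _)
      refine ContinuousAt.comp (f := fun t ↦ x * (AddCircle.toCircle t : ℂ))
        (hF _ hne).continuousAt ?_
      exact (continuous_const.mul
        (continuous_subtype_val.comp AddCircle.continuous_toCircle)).continuousAt⟩
  have hg : ∀ n, fourierCoeff g n = 0 := by
    intro n
    have h1 := laurentIntegral_comp_mul hF hx n
    rw [h n, mul_zero] at h1
    rw [fourierCoeff_eq_intervalIntegral _ n 0, zero_add]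
    have h2 : (∫ t in (0 : ℝ)..2 * Real.pi,
        fourier (-n) (t : AddCircle (2 * Real.pi)) • g (t : AddCircle (2 * Real.pi))) = 0 := by
      rw [← h1]
      refine intervalIntegral.integral_congr fun t _ ↦ ?_
      have hpi : (Real.pi : ℂ) ≠ 0 := by exact_mod_cast Real.pi_ne_zero
      have ht : ((AddCircle.toCircle (t : AddCircle (2 * Real.pi)) : Circle) : ℂ)
          = exp (t * I) := by
        rw [← fourier_one, fourier_coe_apply]
        congr 1
        push_cast
        field_simp
      have htn : fourier (-n) (t : AddCircle (2 * Real.pi)) = exp (t * I) ^ (-n) := by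
        rw [fourier_coe_apply, ← exp_int_mul]
        congr 1
        push_cast
        field_simp
      simp only [htn, smul_eq_mul]
      change _ * F (x * _) = _
      rw [ht]
    rw [h2, smul_zero]
  have hs : Summable (fourierCoeff g) := by
    rw [show fourierCoeff g = fun _ ↦ 0 from funext hg]; exact summable_zero
  have h0 := has_pointwise_sum_fourier_series_of_summable hs 0
  simp only [hg, zero_smul] at h0
  have := h0.unique hasSum_zero
  simpa [g] using this

lemma pPow_add (τ a b : ℂ) : pPow τ (a + b) = pPow τ a * pPow τ b := by
  rw [pPow, pPow, pPow, ← exp_add, mul_add]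

lemma pPow_zero (τ : ℂ) : pPow τ 0 = 1 := by simp [pPow]

lemma pPow_ne_zero (τ a : ℂ) : pPow τ a ≠ 0 := exp_ne_zero _

lemma pPow_zpow (τ a : ℂ) (n : ℤ) : pPow τ a ^ n = pPow τ (n * a) := by
  rw [pPow, pPow, ← exp_int_mul]
  ring_nf

lemma norm_pPow_two_lt_one {τ : ℂ} (hτ : 0 < τ.im) : ‖pPow τ 2‖ < 1 := by
  rw [pPow, norm_exp, Real.exp_lt_one_iff]
  have h : (Real.pi * I * τ * 2 : ℂ).re = -(2 * Real.pi * τ.im) := by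
    simp
    ring
  rw [h]
  have := Real.pi_pos
  simp only [Left.neg_neg_iff]
  positivity

lemma summable_norm_mul_pow (a : ℂ) {q : ℂ} (hq : ‖q‖ < 1) :
    Summable fun j : ℕ ↦ ‖-(a * q ^ j)‖ := by
  simp only [norm_neg, norm_mul, norm_pow]
  exact (summable_geometric_of_lt_one (norm_nonneg _) hq).mul_left _

lemma qpoch_eq {q : ℂ} (hq : ‖q‖ < 1) (a : ℂ) : qpoch a q = (1 - a) * qpoch (q * a) q := by
  have h := multipliable_one_add_of_summable (summable_norm_mul_pow (q * a) hq)
  have e : ∀ j : ℕ, 1 + -(q * a * q ^ j) = 1 - a * q ^ (j + 1) := fun j ↦ by ring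
  simp only [e] at h
  rw [qpoch, tprod_eq_zero_mul' (f := fun j ↦ 1 - a * q ^ j) h, qpoch]
  simp only [pow_zero, mul_one]
  congr 2
  ext j
  ring

lemma differentiable_qpoch {q : ℂ} (hq : ‖q‖ < 1) : Differentiable ℂ fun a ↦ qpoch a q := by
  intro a
  have hu : Summable fun j : ℕ ↦ (‖a‖ + 1) * ‖q‖ ^ j :=
    (summable_geometric_of_lt_one (norm_nonneg _) hq).mul_left _
  have hm := Summable.multipliableLocallyUniformlyOn_nat_one_add
    (f := fun (j : ℕ) (z : ℂ) ↦ -(z * q ^ j)) (K := Metric.ball 0 (‖a‖ + 1))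
    Metric.isOpen_ball hu
    (Filter.Eventually.of_forall fun j z hz ↦ by
      rw [norm_neg, norm_mul, norm_pow]
      have : ‖z‖ ≤ ‖a‖ + 1 := by simpa using (mem_ball_zero_iff.mp hz).le
      gcongr)
    (fun j ↦ by fun_prop)
  have hd := hm.hasProdLocallyUniformlyOn.differentiableOn
    (Filter.Eventually.of_forall fun _ ↦
      DifferentiableOn.fun_finsetProd (fun _ _ ↦ by fun_prop)) Metric.isOpen_ball
  have := hd.differentiableAt (Metric.isOpen_ball.mem_nhds (x := a) (by simp))
  simp only [← sub_eq_add_neg] at this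
  exact this

lemma differentiableAt_theta {q : ℂ} (hq : ‖q‖ < 1) {x : ℂ} (hx : x ≠ 0) :
    DifferentiableAt ℂ (fun y ↦ theta y q) x :=
  (differentiable_qpoch hq x).mul ((differentiable_qpoch hq (q / x)).comp (f := fun y ↦ q / y) x
    ((differentiableAt_const q).div differentiableAt_id hx))

lemma theta_nome_mul {q : ℂ} (hq : ‖q‖ < 1) (hq0 : q ≠ 0) {x : ℂ} (hx : x ≠ 0) :
    theta (q * x) q = -x⁻¹ * theta x q := by
  rw [theta, theta, qpoch_eq hq x, show q / (q * x) = x⁻¹ by field_simp, qpoch_eq hq x⁻¹,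
    ← div_eq_mul_inv]
  field_simp
  ring

lemma theta_nome_div {q : ℂ} (hq0 : q ≠ 0) {x : ℂ} (hx : x ≠ 0) :
    theta (q / x) q = theta x q := by
  rw [theta, theta, mul_comm, show q / (q / x) = x by field_simp]

lemma theta_inv {q : ℂ} (hq : ‖q‖ < 1) (hq0 : q ≠ 0) {x : ℂ} (hx : x ≠ 0) :
    theta x⁻¹ q = -x⁻¹ * theta x q := by
  rw [← theta_nome_mul hq hq0 hx, ← theta_nome_div hq0 (mul_ne_zero hq0 hx)]
  congr 1
  field_simp

/-- Sequences with the symmetries of the normalized Laurent coefficients. -/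
structure SixQuasiPeriodic (b : ℤ → ℂ) (ε : ℂ) : Prop where
  sign : ε = 1 ∨ ε = -1
  add_six : ∀ n, b (n + 6) = ε * b n
  neg : ∀ n, b (-n) = -b n
  three : b 3 = 0
  odd : ε = -1 → b 1 = 0

namespace SixQuasiPeriodic

variable {b : ℤ → ℂ} {ε : ℂ}

lemma add_six_mul (h : SixQuasiPeriodic b ε) (k n : ℤ) : b (n + 6 * k) = ε ^ k * b n := by
  have h0 : ε ≠ 0 := by rcases h.sign with h | h <;> simp [h]
  induction k using Int.induction_on with
  | zero => simp
  | succ k ih =>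
    rw [show n + 6 * ((k : ℤ) + 1) = n + 6 * k + 6 by ring, h.add_six, ih, zpow_add_one₀ h0]
    ring
  | pred k ih =>
    have := h.add_six (n + 6 * (-(k : ℤ) - 1))
    rw [show n + 6 * (-(k : ℤ) - 1) + 6 = n + 6 * -k by ring, ih] at this
    rw [zpow_sub_one₀ h0]
    field_simp
    linear_combination -this

lemma apply_zero (h : SixQuasiPeriodic b ε) : b 0 = 0 := by
  have := h.neg 0
  simp only [neg_zero] at this
  linear_combination this / 2

lemma three_mul (h : SixQuasiPeriodic b ε) (k : ℤ) : b (3 * k) = 0 := by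
  rcases Int.even_or_odd' k with ⟨m, rfl | rfl⟩
  · rw [show 3 * (2 * m) = 0 + 6 * m by ring, h.add_six_mul, h.apply_zero, mul_zero]
  · rw [show 3 * (2 * m + 1) = 3 + 6 * m by ring, h.add_six_mul, h.three, mul_zero]

lemma sum_eq_zero (h : SixQuasiPeriodic b ε) (n : ℤ) : b (n + 4) + b n + b (n - 4) = 0 := by
  have hn := Int.emod_add_mul_ediv n 6
  set r := n % 6 with hr
  set k := n / 6
  have hr0 : 0 ≤ r := Int.emod_nonneg _ (by norm_num)
  have hr6 : r < 6 := Int.emod_lt_of_pos _ (by norm_num)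
  rw [← hn, show r + 6 * k + 4 = r + 4 + 6 * k by ring,
    show r + 6 * k - 4 = r - 4 + 6 * k by ring, h.add_six_mul, h.add_six_mul, h.add_six_mul,
    ← mul_add, ← mul_add]
  refine mul_eq_zero_of_right _ ?_
  have h0 := h.apply_zero
  have h3 := h.three
  have n1 := h.neg 1
  have n2 := h.neg 2
  have n3 := h.neg 3
  have n4 := h.neg 4
  have a4 := h.add_six (-4)
  have a3 := h.add_six (-3)
  have a2 := h.add_six (-2)
  have a1 := h.add_six (-1)
  have a0 := h.add_six 0
  have b1 := h.add_six 1
  have b2 := h.add_six 2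
  have b3 := h.add_six 3
  have ho := h.odd
  clear_value r k
  clear hn hr
  rcases h.sign with he | he <;> subst he <;> clear h <;> interval_cases r <;>
    norm_num at * <;> grind

end SixQuasiPeriodic

/-- Both three-term relations for a function whose Laurent coefficients are forced by its
quasi-period, its parity and its antisymmetry under inversion. -/
lemma three_term_relations {τ : ℂ} {f : ℂ → ℂ} (hd : ∀ z ≠ 0, DifferentiableAt ℂ f z)
    {ε σ : ℂ} (hεσ : ε = 1 ∧ σ = -1 ∨ σ = 1 ∧ (ε = 1 ∨ ε = -1))
    (hper : ∀ z ≠ 0, f (pPow τ 1 * z) = ε * pPow τ (-3) * (z ^ (-6 : ℤ) * f z))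
    (hinv : ∀ z ≠ 0, f z⁻¹ = -1 * f z) (hpar : ∀ z ≠ 0, f (-1 * z) = σ * f z)
    {x : ℂ} (hx : x ≠ 0) :
    f (omg⁻¹ * x) + f x + f (omg * x) = 0 ∧
      x ^ (-4 : ℤ) * f (pPow τ (-(2/3)) * x) + pPow τ (-(4/3)) * f x +
        x ^ 4 * f (pPow τ (2/3) * x) = 0 := by
  set a := laurentIntegral f with ha
  have hε : ε = 1 ∨ ε = -1 := by tauto
  have hεε : ε * ε = 1 := by rcases hε with h | h <;> simp [h]
  have haper : ∀ n : ℤ, a (n + 6) = ε * pPow τ (n + 3) * a n := by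
    intro n
    have h := laurentIntegral_congr hper n
    rw [laurentIntegral_comp_mul hd (pPow_ne_zero _ _), laurentIntegral_const_mul,
      laurentIntegral_zpow_mul, pPow_zpow, mul_one, sub_neg_eq_add, ← ha] at h
    have h3 : pPow τ 3 * pPow τ (-3) = 1 := by rw [← pPow_add, add_neg_cancel, pPow_zero]
    rw [pPow_add]
    linear_combination (-ε * pPow τ 3) * h - (a (n + 6)) * (ε * ε * h3 + hεε)
  have haneg : ∀ n : ℤ, a (-n) = -a n := by
    intro n
    have h := laurentIntegral_congr hinv n
    rw [laurentIntegral_comp_inv, laurentIntegral_const_mul] at h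
    rw [ha, h]
    ring
  have hapar : ∀ n : ℤ, (-1) ^ n * a n = σ * a n := by
    intro n
    have h := laurentIntegral_congr hpar n
    rwa [laurentIntegral_comp_mul hd (by norm_num), laurentIntegral_const_mul] at h
  let b : ℤ → ℂ := fun n ↦ a n * pPow τ (-(n ^ 2 / 12))
  have hab : ∀ n : ℤ, a n = b n * pPow τ (n ^ 2 / 12) := by
    intro n
    simp only [b]
    rw [mul_assoc, ← pPow_add, neg_add_cancel, pPow_zero, mul_one]
  have hbper : ∀ n, b (n + 6) = ε * b n := by
    intro n
    simp only [b]
    rw [haper, show -(((n + 6 : ℤ) : ℂ) ^ 2 / 12) = -(n + 3) + -((n : ℂ) ^ 2 / 12) by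
      push_cast; ring, pPow_add τ (-(n + 3))]
    have h3 : pPow τ (n + 3) * pPow τ (-(n + 3)) = 1 := by
      rw [← pPow_add, add_neg_cancel, pPow_zero]
    linear_combination (ε * a n * pPow τ (-((n : ℂ) ^ 2 / 12))) * h3
  have hbneg : ∀ n, b (-n) = -b n := by
    intro n
    simp only [b, haneg]
    push_cast
    ring_nf
  have hodd : σ = 1 → ∀ n : ℤ, Odd n → b n = 0 := by
    intro h n hn
    have := hapar n
    rw [hn.neg_one_zpow, h] at this
    have h0 : a n = 0 := by linear_combination -this / 2
    simp [b, h0]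
  have hb : SixQuasiPeriodic b ε := by
    refine ⟨hε, hbper, hbneg, ?_, ?_⟩
    · rcases hεσ with ⟨h, -⟩ | ⟨h, -⟩
      · have h1 := hbper (-3)
        have h2 := hbneg 3
        rw [h] at h1
        norm_num at h1
        linear_combination (h1 + h2) / 2
      · exact hodd h 3 (by decide)
    · intro he
      rcases hεσ with ⟨h, -⟩ | ⟨h, -⟩
      · rw [h] at he
        norm_num at he
      · exact hodd h 1 (by decide)
  have hd_scale : ∀ c : ℂ, c ≠ 0 → ∀ z ≠ 0, DifferentiableAt ℂ (fun z ↦ f (c * z)) z :=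
    fun c hc z hz ↦ (hd _ (mul_ne_zero hc hz)).comp z (by fun_prop)
  constructor
  · have homg : omg ≠ 0 := exp_ne_zero _
    have hprim : IsPrimitiveRoot omg 3 := by
      have := isPrimitiveRoot_exp 3 (by norm_num)
      simpa [omg] using this
    have h12 : ∀ z ≠ 0, DifferentiableAt ℂ (fun z ↦ f (omg⁻¹ * z) + f z) z :=
      fun z hz ↦ (hd_scale _ (inv_ne_zero homg) z hz).add (hd z hz)
    refine eq_zero_of_laurentIntegral_eq_zero
      (F := fun z ↦ f (omg⁻¹ * z) + f z + f (omg * z))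
      (fun z hz ↦ (h12 z hz).add (hd_scale _ homg z hz)) (fun n ↦ ?_) hx
    rw [laurentIntegral_add h12 (hd_scale _ homg),
      laurentIntegral_add (hd_scale _ (inv_ne_zero homg)) hd,
      laurentIntegral_comp_mul hd (inv_ne_zero homg), laurentIntegral_comp_mul hd homg, ← ha]
    by_cases h3 : (3 : ℤ) ∣ n
    · obtain ⟨k, rfl⟩ := h3
      rw [hab, hb.three_mul]
      ring
    · have hne : omg ^ n ≠ 1 := fun h ↦ h3 (by
        simpa using (hprim.zpow_eq_one_iff_dvd n).mp h)
      have hcube : (omg ^ n) ^ 3 = 1 := by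
        rw [← zpow_natCast, ← zpow_mul, mul_comm, zpow_mul, zpow_natCast, hprim.pow_eq_one,
          one_zpow]
      have hsum : (omg ^ n) ^ 2 + omg ^ n + 1 = 0 :=
        mul_left_cancel₀ (sub_ne_zero.mpr hne) (by linear_combination hcube)
      have hn0 : omg ^ n ≠ 0 := zpow_ne_zero _ homg
      rw [inv_zpow]
      field_simp
      linear_combination a n * hsum
  · have d1 : ∀ z ≠ 0,
        DifferentiableAt ℂ (fun z ↦ z ^ (-4 : ℤ) * f (pPow τ (-(2/3)) * z)) z :=
      fun z hz ↦ (differentiableAt_zpow.mpr (Or.inl hz)).mul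
        (hd_scale _ (pPow_ne_zero _ _) z hz)
    have d2 : ∀ z ≠ 0, DifferentiableAt ℂ (fun z ↦ pPow τ (-(4/3)) * f z) z :=
      fun z hz ↦ (hd z hz).const_mul _
    have d3 : ∀ z ≠ 0,
        DifferentiableAt ℂ (fun z ↦ z ^ (4 : ℤ) * f (pPow τ (2/3) * z)) z :=
      fun z hz ↦ (differentiableAt_zpow.mpr (Or.inl hz)).mul
        (hd_scale _ (pPow_ne_zero _ _) z hz)
    have d12 := fun z hz ↦ (d1 z hz).fun_add (d2 z hz)
    have := eq_zero_of_laurentIntegral_eq_zero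
      (F := fun z ↦ z ^ (-4 : ℤ) * f (pPow τ (-(2/3)) * z) + pPow τ (-(4/3)) * f z +
        z ^ (4 : ℤ) * f (pPow τ (2/3) * z))
      (fun z hz ↦ (d12 z hz).fun_add (d3 z hz)) (fun n ↦ ?_) hx
    · exact_mod_cast this
    rw [laurentIntegral_add d12 d3, laurentIntegral_add d1 d2, laurentIntegral_zpow_mul,
      laurentIntegral_zpow_mul, laurentIntegral_const_mul,
      laurentIntegral_comp_mul hd (pPow_ne_zero _ _),
      laurentIntegral_comp_mul hd (pPow_ne_zero _ _), pPow_zpow, pPow_zpow, sub_neg_eq_add,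
      ← ha, hab, hab n, hab (n - 4)]
    have e1 : pPow τ ((n + 4 : ℤ) * -(2/3)) * pPow τ (((n + 4 : ℤ) : ℂ) ^ 2 / 12) =
        pPow τ (-(4/3)) * pPow τ ((n : ℂ) ^ 2 / 12) := by
      rw [← pPow_add, ← pPow_add]
      push_cast
      ring_nf
    have e2 : pPow τ ((n - 4 : ℤ) * (2/3)) * pPow τ (((n - 4 : ℤ) : ℂ) ^ 2 / 12) =
        pPow τ (-(4/3)) * pPow τ ((n : ℂ) ^ 2 / 12) := by
      rw [← pPow_add, ← pPow_add]
      push_cast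
      ring_nf
    linear_combination b (n + 4) * e1 + b (n - 4) * e2 +
      pPow τ (-(4/3)) * pPow τ ((n : ℂ) ^ 2 / 12) * hb.sum_eq_zero n

theorem stmt1 (τ : ℂ) (hτ : 0 < τ.im) (f : ℂ → ℂ)
    (hf : (∀ x : ℂ, f x = x ^ (-1 : ℤ) *
            (theta (x ^ 2) (pPow τ 2) * theta (pPow τ 1 * x ^ 2) (pPow τ 2) *
              theta (-(pPow τ 1 * x ^ 2)) (pPow τ 2))) ∨
          (∀ x : ℂ, f x = x ^ (-2 : ℤ) *
            (theta (x ^ 2) (pPow τ 2) * theta (-x ^ 2) (pPow τ 2) *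
              theta (pPow τ 1 * x ^ 2) (pPow τ 2))) ∨
          (∀ x : ℂ, f x = x ^ (-2 : ℤ) *
            (theta (x ^ 2) (pPow τ 2) * theta (-x ^ 2) (pPow τ 2) *
              theta (-(pPow τ 1 * x ^ 2)) (pPow τ 2)))) :
    ∀ x : ℂ, x ≠ 0 →
      (f (omg⁻¹ * x) + f x + f (omg * x) = 0 ∧
       x ^ (-4 : ℤ) * f (pPow τ (-(2/3)) * x) + pPow τ (-(4/3)) * f x +
         x ^ 4 * f (pPow τ (2/3) * x) = 0) := by
  intro x hx
  have hq := norm_pPow_two_lt_one hτ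
  have hq0 := pPow_ne_zero τ 2
  have hP := pPow_ne_zero τ 1
  have hPP : pPow τ 2 = pPow τ 1 ^ 2 := by rw [sq, ← pPow_add]; norm_num
  have hP3 : pPow τ (-3) = (pPow τ 1 ^ 3)⁻¹ := by
    rw [show (-3 : ℂ) = ((-3 : ℤ) : ℂ) * 1 by norm_num, ← pPow_zpow, zpow_neg]
    rfl
  generalize pPow τ 2 = q at *
  have dth : ∀ c : ℂ, c ≠ 0 → ∀ z ≠ 0, DifferentiableAt ℂ (fun z ↦ theta (c * z ^ 2) q) z :=
    fun c hc z hz ↦ (differentiableAt_theta hq (mul_ne_zero hc (pow_ne_zero 2 hz))).comp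
      (f := fun z ↦ c * z ^ 2) z (by fun_prop)
  have tper : ∀ c : ℂ, c ≠ 0 → ∀ z ≠ 0,
      theta (c * (pPow τ 1 * z) ^ 2) q = -(c * z ^ 2)⁻¹ * theta (c * z ^ 2) q :=
    fun c hc z hz ↦ by
      rw [← theta_nome_mul hq hq0 (mul_ne_zero hc (pow_ne_zero 2 hz))]
      congr 1
      rw [hPP]
      ring
  have tinv : ∀ c : ℂ, c * c = 1 → ∀ z ≠ 0,
      theta (c * z⁻¹ ^ 2) q = -(c * z ^ 2)⁻¹ * theta (c * z ^ 2) q :=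
    fun c hc z hz ↦ by
      have hc0 : c ≠ 0 := left_ne_zero_of_mul_eq_one hc
      rw [← theta_inv hq hq0 (mul_ne_zero hc0 (pow_ne_zero 2 hz))]
      congr 1
      rw [mul_inv, inv_pow, inv_eq_of_mul_eq_one_left hc]
  have tdiv : ∀ c : ℂ, c * c = q → ∀ z ≠ 0,
      theta (c * z⁻¹ ^ 2) q = theta (c * z ^ 2) q :=
    fun c hc z hz ↦ by
      have hc0 : c ≠ 0 := fun h ↦ hq0 (by rw [← hc, h, zero_mul])
      rw [← theta_nome_div hq0 (mul_ne_zero hc0 (pow_ne_zero 2 hz))]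
      congr 1
      rw [← hc]
      field_simp
  have o1 : (1 : ℂ) ≠ 0 := one_ne_zero
  have o2 : (-1 : ℂ) ≠ 0 := by norm_num
  have o3 : -pPow τ 1 ≠ 0 := neg_ne_zero.mpr hP
  have s1 : pPow τ 1 * pPow τ 1 = q := by rw [hPP, sq]
  have s2 : -pPow τ 1 * -pPow τ 1 = q := by rw [neg_mul_neg, s1]
  rcases hf with hf | hf | hf
  · have hf' : f = fun z ↦ z ^ (-1 : ℤ) * (theta (1 * z ^ 2) q * theta (pPow τ 1 * z ^ 2) q *
        theta (-pPow τ 1 * z ^ 2) q) := by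
      ext z; rw [hf]; simp only [one_mul, neg_mul]
    refine three_term_relations (ε := 1) (σ := -1) ?_ (by norm_num) ?_ ?_ ?_ hx <;> rw [hf']
    · exact fun z hz ↦ (differentiableAt_zpow.mpr (Or.inl hz)).mul
        (((dth _ o1 z hz).mul (dth _ hP z hz)).mul (dth _ o3 z hz))
    · intro z hz
      simp only [tper _ o1 z hz, tper _ hP z hz, tper _ o3 z hz, hP3, zpow_neg, zpow_ofNat]
      field_simp
    · intro z hz
      simp only [tinv 1 (by norm_num) z hz, tdiv _ s1 z hz, tdiv _ s2 z hz, zpow_neg, zpow_ofNat]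
      field_simp
    · intro z hz
      simp only [neg_mul, one_mul, neg_sq, zpow_neg, zpow_ofNat, pow_one, inv_neg]
  · have hf' : f = fun z ↦ z ^ (-2 : ℤ) * (theta (1 * z ^ 2) q * theta (-1 * z ^ 2) q *
        theta (pPow τ 1 * z ^ 2) q) := by
      ext z; rw [hf]; simp only [one_mul, neg_mul]
    refine three_term_relations (ε := 1) (σ := 1) ?_ (by norm_num) ?_ ?_ ?_ hx <;> rw [hf']
    · exact fun z hz ↦ (differentiableAt_zpow.mpr (Or.inl hz)).mul
        (((dth _ o1 z hz).mul (dth _ o2 z hz)).mul (dth _ hP z hz))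
    · intro z hz
      simp only [tper _ o1 z hz, tper _ o2 z hz, tper _ hP z hz, hP3, zpow_neg, zpow_ofNat]
      field_simp
    · intro z hz
      simp only [tinv 1 (by norm_num) z hz, tinv (-1) (by norm_num) z hz, tdiv _ s1 z hz,
        zpow_neg, zpow_ofNat]
      field_simp
    · intro z hz
      simp only [neg_mul, one_mul, neg_sq, zpow_neg, zpow_ofNat]
  · have hf' : f = fun z ↦ z ^ (-2 : ℤ) * (theta (1 * z ^ 2) q * theta (-1 * z ^ 2) q *
        theta (-pPow τ 1 * z ^ 2) q) := by
      ext z; rw [hf]; simp only [one_mul, neg_mul]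
    refine three_term_relations (ε := -1) (σ := 1) ?_ (by norm_num) ?_ ?_ ?_ hx <;> rw [hf']
    · exact fun z hz ↦ (differentiableAt_zpow.mpr (Or.inl hz)).mul
        (((dth _ o1 z hz).mul (dth _ o2 z hz)).mul (dth _ o3 z hz))
    · intro z hz
      simp only [tper _ o1 z hz, tper _ o2 z hz, tper _ o3 z hz, hP3, zpow_neg, zpow_ofNat]
      field_simp
    · intro z hz
      simp only [tinv 1 (by norm_num) z hz, tinv (-1) (by norm_num) z hz, tdiv _ s2 z hz,
        zpow_neg, zpow_ofNat]
      field_simp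
    · intro z hz
      simp only [neg_mul, one_mul, neg_sq, zpow_neg, zpow_ofNat]

end
end

section
/- Let τ lie in the upper half-plane, p^λ=e^{iπτλ}, and ω=e^{2πi/3}. Then for all x∈ℂ∖{0}: x^{−1}θ(x²,px²,−px²;p²) = ((p⁶;p⁶)_∞/(p²;p²)_∞)·(x^{−1}θ(−p²x⁶;p⁶) − xθ(−p⁴x⁶;p⁶)) = ((p^{2/3};p^{2/3})_∞/((1−ω)(p²;p²)_∞))·x^{−1}·(θ(−ωx²;p^{2/3}) − ωθ(−ω²x²;p^{2/3})), and x^{−2}θ(x²,−x²,px²;p²) = ((p⁶;p⁶)_∞/(p²;p²)_∞)·(x^{−2}θ(−px⁶;p⁶) − x²θ(−p⁵x⁶;p⁶)) = (p^{−1/3}(p^{2/3};p^{2/3})_∞/((ω−ω²)(p²;p²)_∞))·(θ(−ω²p^{1/3}x²;p^{2/3}) − θ(−ωp^{1/3}x²;p^{2/3})). -/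
open Complex BigOperators Finset

noncomputable section

open Filter Topology

theorem summable_qpoch_term (a : ℂ) {p : ℂ} (hp : ‖p‖ < 1) :
    Summable fun j : ℕ => ‖-(a * p ^ j)‖ := by
  simpa using (summable_geometric_of_lt_one (norm_nonneg p) hp).mul_left ‖a‖

theorem multipliable_qpoch (a : ℂ) {p : ℂ} (hp : ‖p‖ < 1) :
    Multipliable fun j : ℕ => 1 - a * p ^ j := by
  simpa [sub_eq_add_neg] using multipliable_one_add_of_summable (summable_qpoch_term a hp)

theorem tendsto_qpoch (a : ℂ) {p : ℂ} (hp : ‖p‖ < 1) :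
    Tendsto (fun N => ∏ j ∈ range N, (1 - a * p ^ j)) atTop (𝓝 (qpoch a p)) :=
  (multipliable_qpoch a hp).tendsto_prod_tprod_nat

theorem one_sub_pow_succ_ne_zero {p : ℂ} (hp : ‖p‖ < 1) (n : ℕ) : 1 - p ^ (n + 1) ≠ 0 := by
  intro h
  have h1 : ‖p ^ (n + 1)‖ = 1 := by
    rw [← sub_eq_zero.mp h]; simp
  rw [norm_pow] at h1
  exact absurd h1 (pow_lt_one₀ (norm_nonneg p) hp (Nat.succ_ne_zero n)).ne

theorem qpoch_self_ne_zero {p : ℂ} (hp : ‖p‖ < 1) : qpoch p p ≠ 0 := by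
  have := tprod_one_add_ne_zero_of_summable (f := fun j : ℕ => -(p * p ^ j)) (fun j => by
    have := one_sub_pow_succ_ne_zero hp j
    rwa [pow_succ', sub_eq_add_neg] at this) (summable_qpoch_term p hp)
  simpa [qpoch, sub_eq_add_neg] using this

theorem qpoch_eq_one_sub_mul (a : ℂ) {p : ℂ} (hp : ‖p‖ < 1) :
    qpoch a p = (1 - a) * qpoch (a * p) p := by
  refine tendsto_nhds_unique ((tendsto_add_atTop_iff_nat 1).mpr (tendsto_qpoch a hp)) ?_
  refine ((tendsto_qpoch (a * p) hp).const_mul (1 - a)).congr fun N => ?_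
  rw [prod_range_succ']
  simp only [pow_zero, mul_one, pow_succ']
  rw [mul_comm]
  simp only [mul_assoc]

theorem theta_mul_self {z p : ℂ} (hz : z ≠ 0) (hp0 : p ≠ 0) (hp : ‖p‖ < 1) :
    theta (p * z) p = -z⁻¹ * theta z p := by
  have h1 := qpoch_eq_one_sub_mul z hp
  have h2 := qpoch_eq_one_sub_mul z⁻¹ hp
  have h3 : p / (p * z) = z⁻¹ := by field_simp
  have h4 : p / z = z⁻¹ * p := by field_simp
  rw [theta, theta, h3, h1, h2, h4, mul_comm p z]
  field_simp
  ring

theorem qpoch_mul_qpoch_neg (a : ℂ) {p : ℂ} (hp : ‖p‖ < 1) :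
    qpoch a p * qpoch (-a) p = qpoch (a ^ 2) (p ^ 2) := by
  rw [qpoch, qpoch, qpoch, ← (multipliable_qpoch a hp).tprod_mul (multipliable_qpoch (-a) hp)]
  refine tprod_congr fun j => ?_
  ring

theorem theta_mul_theta_neg (a : ℂ) {p : ℂ} (hp : ‖p‖ < 1) :
    theta a p * theta (-a) p = theta (a ^ 2) (p ^ 2) := by
  rw [theta, theta, theta, mul_mul_mul_comm, qpoch_mul_qpoch_neg a hp, div_neg,
    qpoch_mul_qpoch_neg (p / a) hp, div_pow]

theorem qpoch_trisect (a : ℂ) {p : ℂ} (hp : ‖p‖ < 1) :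
    qpoch a p = qpoch a (p ^ 3) * qpoch (a * p) (p ^ 3) * qpoch (a * p ^ 2) (p ^ 3) := by
  have hp3 : ‖p ^ 3‖ < 1 := by
    rw [norm_pow]; exact pow_lt_one₀ (norm_nonneg p) hp (by norm_num)
  have h3 : Tendsto (fun N : ℕ => 3 * N) atTop atTop :=
    tendsto_id.const_mul_atTop' (by norm_num)
  refine tendsto_nhds_unique ((tendsto_qpoch a hp).comp h3) ?_
  refine (((tendsto_qpoch a hp3).mul (tendsto_qpoch (a * p) hp3)).mul
    (tendsto_qpoch (a * p ^ 2) hp3)).congr fun N => ?_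
  simp only [Function.comp]
  induction N with
  | zero => simp
  | succ N ih =>
    rw [show 3 * (N + 1) = 3 * N + 1 + 1 + 1 by ring]
    simp only [prod_range_succ]
    rw [← ih]
    ring

/-- The reciprocal of `(q; q)_m`, extended by zero to negative indices. -/
def recipQFactorial (q : ℂ) (m : ℤ) : ℂ :=
  if 0 ≤ m then (∏ j ∈ range m.toNat, (1 - q * q ^ j))⁻¹ else 0

theorem recipQFactorial_sub_one {q : ℂ} (hq : ‖q‖ < 1) (m : ℤ) :
    recipQFactorial q (m - 1) = (1 - q ^ m) * recipQFactorial q m := by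
  rcases lt_trichotomy m 0 with h | rfl | h
  · simp [recipQFactorial, show ¬ (0 ≤ m) by omega, show ¬ (1 ≤ m) by omega]
  · simp [recipQFactorial]
  · obtain ⟨k, rfl⟩ : ∃ k : ℕ, m = k + 1 := ⟨(m - 1).toNat, by omega⟩
    have h0 := one_sub_pow_succ_ne_zero hq k
    have h1 : (q ^ ((k : ℤ) + 1)) = q ^ (k + 1) := by exact_mod_cast zpow_natCast q (k + 1)
    have h2 : ((k : ℤ) + 1).toNat = k + 1 := by omega
    simp only [recipQFactorial, h1, h2, add_sub_cancel_right, Int.toNat_natCast,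
      prod_range_succ]
    rw [if_pos (by omega), if_pos (by omega), mul_inv, ← pow_succ', mul_comm, mul_assoc,
      inv_mul_cancel₀ h0, mul_one]

theorem tendsto_recipQFactorial {q : ℂ} (hq : ‖q‖ < 1) :
    Tendsto (fun N : ℕ => recipQFactorial q N) atTop (𝓝 (qpoch q q)⁻¹) := by
  refine ((tendsto_qpoch q hq).inv₀ (qpoch_self_ne_zero hq)).congr fun N => ?_
  simp [recipQFactorial]

theorem exists_norm_recipQFactorial_le {q : ℂ} (hq : ‖q‖ < 1) :
    ∃ C : ℝ, 0 ≤ C ∧ ∀ m : ℤ, ‖recipQFactorial q m‖ ≤ C := by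
  obtain ⟨C, hC⟩ := (Metric.isBounded_range_of_tendsto _
    (tendsto_recipQFactorial hq)).exists_norm_le
  refine ⟨max C 0, le_max_right _ _, fun m => ?_⟩
  rcases le_or_gt 0 m with h | h
  · lift m to ℕ using h
    exact (hC _ ⟨m, rfl⟩).trans (le_max_left _ _)
  · simp [recipQFactorial, not_le.mpr h]

/-- The coefficient of `z ^ n` in `∏ j < N, (1 + z q ^ j) (1 + q ^ (j + 1) / z)`, where `q = h ^ 2`,
divided by `h ^ (n * (n - 1))`. -/
def centralQBinom (q : ℂ) (N : ℕ) (n : ℤ) : ℂ :=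
  (∏ j ∈ range (2 * N), (1 - q * q ^ j)) *
    (recipQFactorial q (N + n) * recipQFactorial q (N - n))

theorem centralQBinom_succ {q : ℂ} (hq0 : q ≠ 0) (hq : ‖q‖ < 1) (N : ℕ) (n : ℤ) :
    centralQBinom q (N + 1) n = (1 + q ^ (2 * N + 1)) * centralQBinom q N n
      + q ^ ((N : ℤ) + 1 - n) * centralQBinom q N (n - 1)
      + q ^ ((N : ℤ) + 1 + n) * centralQBinom q N (n + 1) := by
  have a1 := recipQFactorial_sub_one hq (N + n + 1)
  have a2 := recipQFactorial_sub_one hq (N + n)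
  have b1 := recipQFactorial_sub_one hq (N - n + 1)
  have b2 := recipQFactorial_sub_one hq (N - n)
  simp only [add_sub_cancel_right] at a1 b1
  rw [a1] at a2
  rw [b1] at b2
  have e : q ^ (2 * N) = q ^ ((N : ℤ) + n) * q ^ ((N : ℤ) - n) := by
    rw [← zpow_add₀ hq0, ← zpow_natCast]; congr 1; push_cast; ring
  simp only [centralQBinom, show 2 * (N + 1) = 2 * N + 1 + 1 by ring, prod_range_succ]
  push_cast
  rw [show (N : ℤ) + 1 + n = N + n + 1 by ring, show (N : ℤ) + 1 - n = N - n + 1 by ring,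
    show (N : ℤ) + (n - 1) = N + n - 1 by ring, show (N : ℤ) - (n - 1) = N - n + 1 by ring,
    show (N : ℤ) + (n + 1) = N + n + 1 by ring, show (N : ℤ) - (n + 1) = N - n - 1 by ring,
    a1, b1, a2, b2]
  simp only [zpow_add_one₀ hq0, pow_succ, e]
  ring

theorem centralQBinom_zero (q : ℂ) (n : ℤ) : centralQBinom q 0 n = if n = 0 then 1 else 0 := by
  rcases lt_trichotomy n 0 with h | rfl | h
  · simp [centralQBinom, recipQFactorial, not_le.mpr h, h.ne]
  · simp [centralQBinom, recipQFactorial]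
  · simp [centralQBinom, recipQFactorial, not_le.mpr h, h.ne']

theorem hasSum_prod_theta_factors {h z : ℂ} (hh0 : h ≠ 0) (hh : ‖h ^ 2‖ < 1) (hz : z ≠ 0) (N : ℕ) :
    HasSum (fun n : ℤ => centralQBinom (h ^ 2) N n * (h ^ (n * (n - 1)) * z ^ n))
      (∏ j ∈ range N, (1 + z * (h ^ 2) ^ j) * (1 + h ^ 2 / z * (h ^ 2) ^ j)) := by
  induction N with
  | zero =>
    rw [prod_range_zero]
    refine (hasSum_ite_eq (0 : ℤ) (1 : ℂ)).congr_fun fun n => ?_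
    rw [centralQBinom_zero]
    split_ifs with hn
    · simp [hn]
    · simp
  | succ N ih =>
    rw [prod_range_succ]
    have hm := (Equiv.subRight (1 : ℤ)).hasSum_iff.mpr ih
    have hp := (Equiv.addRight (1 : ℤ)).hasSum_iff.mpr ih
    have hstep := ((ih.mul_left (1 + (h ^ 2) ^ (2 * N + 1))).add
      (hm.mul_left (z * (h ^ 2) ^ N))).add (hp.mul_left (h ^ 2 / z * (h ^ 2) ^ N))
    rw [← add_mul, ← add_mul, show 1 + (h ^ 2) ^ (2 * N + 1) + z * (h ^ 2) ^ N
      + h ^ 2 / z * (h ^ 2) ^ N = (1 + z * (h ^ 2) ^ N) * (1 + h ^ 2 / z * (h ^ 2) ^ N) by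
        field_simp; ring, mul_comm ((1 + z * (h ^ 2) ^ N) * _)] at hstep
    refine hstep.congr_fun fun n => ?_
    rw [centralQBinom_succ (pow_ne_zero 2 hh0) hh]
    simp only [Function.comp, Equiv.subRight_apply, Equiv.coe_addRight]
    have e1 : (h ^ 2) ^ ((N : ℤ) + 1 - n) * (h ^ (n * (n - 1)) * z ^ n)
        = z * (h ^ 2) ^ N * (h ^ ((n - 1) * (n - 1 - 1)) * z ^ (n - 1)) := by
      rw [zpow_sub_one₀ hz, ← zpow_natCast (h ^ 2) N, ← zpow_natCast h 2, ← zpow_mul, ← zpow_mul]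
      field_simp
      rw [← zpow_add₀ hh0, ← zpow_add₀ hh0]
      congr 1; push_cast; ring
    have e2 : (h ^ 2) ^ ((N : ℤ) + 1 + n) * (h ^ (n * (n - 1)) * z ^ n)
        = h ^ 2 / z * (h ^ 2) ^ N * (h ^ ((n + 1) * (n + 1 - 1)) * z ^ (n + 1)) := by
      rw [zpow_add_one₀ hz, ← zpow_natCast (h ^ 2) N, ← zpow_natCast h 2, ← zpow_mul, ← zpow_mul]
      field_simp
      rw [← zpow_add₀ hh0, ← zpow_add₀ hh0, ← zpow_add₀ hh0]
      congr 1; push_cast; ring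
    linear_combination centralQBinom (h ^ 2) N (n - 1) * e1
      + centralQBinom (h ^ 2) N (n + 1) * e2

theorem summable_zpow_mul_zpow {h z : ℂ} (hh0 : h ≠ 0) (hh : ‖h‖ < 1) (hz : z ≠ 0) :
    Summable fun n : ℤ => h ^ (n * (n - 1)) * z ^ n := by
  have hpi : (Real.pi : ℂ) * I ≠ 0 := by simp [Real.pi_ne_zero]
  have him : 0 < (log h / (Real.pi * I)).im := by
    have h1 : log h / (Real.pi * I) = -(I * log h) / (Real.pi : ℝ) := by
      field_simp
      simp
    rw [h1, div_ofReal_im]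
    have := Real.log_neg (norm_pos_iff.mpr hh0) hh
    simp only [neg_im, mul_im, I_re, I_im, log_re]
    apply div_pos _ Real.pi_pos
    linarith
  refine ((summable_jacobiTheta₂_term_iff (log (z / h) / (2 * Real.pi * I)) _).mpr him).congr
    fun n => ?_
  have e1 : 2 * Real.pi * I * n * (log (z / h) / (2 * Real.pi * I)) = n * log (z / h) := by
    field_simp
  have e2 : Real.pi * I * n ^ 2 * (log h / (Real.pi * I)) = ((n ^ 2 : ℤ) : ℂ) * log h := by
    push_cast; field_simp
  rw [jacobiTheta₂_term, e1, e2, exp_add, exp_int_mul, exp_int_mul, exp_log (div_ne_zero hz hh0),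
    exp_log hh0, div_zpow, mul_sub, mul_one, zpow_sub₀ hh0, sq]
  field_simp

/-- The bilateral theta series `∑ n, h ^ (n * (n - 1)) * z ^ n`. -/
def thetaSeries (h z : ℂ) : ℂ := ∑' n : ℤ, h ^ (n * (n - 1)) * z ^ n

/-- Jacobi's triple product identity. -/
theorem qpoch_mul_theta_neg {h z : ℂ} (hh0 : h ≠ 0) (hh : ‖h‖ < 1) (hz : z ≠ 0) :
    qpoch (h ^ 2) (h ^ 2) * theta (-z) (h ^ 2) = thetaSeries h z := by
  have hq : ‖h ^ 2‖ < 1 := by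
    rw [norm_pow]; exact pow_lt_one₀ (norm_nonneg h) hh (by norm_num)
  set L := qpoch (h ^ 2) (h ^ 2) with hL
  have hL0 : L ≠ 0 := qpoch_self_ne_zero hq
  have hprod : Tendsto (fun N => ∏ j ∈ range N,
      (1 + z * (h ^ 2) ^ j) * (1 + h ^ 2 / z * (h ^ 2) ^ j)) atTop (𝓝 (theta (-z) (h ^ 2))) := by
    refine ((tendsto_qpoch (-z) hq).mul (tendsto_qpoch (h ^ 2 / -z) hq)).congr fun N => ?_
    rw [← prod_mul_distrib]
    refine prod_congr rfl fun j _ => ?_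
    rw [div_neg]; ring
  have htwo : Tendsto (fun N : ℕ => 2 * N) atTop atTop :=
    tendsto_id.const_mul_atTop' (by norm_num)
  have hnum := (tendsto_qpoch (h ^ 2) hq).comp htwo
  obtain ⟨C, hC0, hC⟩ := exists_norm_recipQFactorial_le hq
  obtain ⟨D, hD⟩ := (Metric.isBounded_range_of_tendsto _ hnum).exists_norm_le
  have hD0 : 0 ≤ D := (norm_nonneg _).trans (hD _ ⟨0, rfl⟩)
  have hcoef (n : ℤ) : Tendsto (fun N => centralQBinom (h ^ 2) N n) atTop (𝓝 L⁻¹) := by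
    have hr (k : ℤ) : Tendsto (fun N : ℕ => recipQFactorial (h ^ 2) (N + k)) atTop (𝓝 L⁻¹) := by
      have ht : Tendsto (fun N : ℕ => ((N : ℤ) + k).toNat) atTop atTop :=
        tendsto_atTop.mpr fun b => by
          filter_upwards [eventually_ge_atTop (b + k.natAbs)] with N hN
          omega
      refine ((tendsto_recipQFactorial hq).comp ht).congr' ?_
      filter_upwards [eventually_ge_atTop k.natAbs] with N hN
      simp only [Function.comp]
      congr 1
      omega
    have := hnum.mul ((hr n).mul (hr (-n)))
    rw [mul_inv_cancel_left₀ hL0] at this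
    exact this
  have hlim := tendsto_tsum_of_dominated_convergence
    (f := fun N (n : ℤ) => centralQBinom (h ^ 2) N n * (h ^ (n * (n - 1)) * z ^ n))
    ((summable_zpow_mul_zpow hh0 hh hz).norm.mul_left (D * (C * C)))
    (fun n => (hcoef n).mul_const _) (Eventually.of_forall fun N n => by
      rw [norm_mul, centralQBinom, norm_mul, norm_mul]
      gcongr
      · exact hD _ ⟨N, rfl⟩
      · exact hC _
      · exact hC _)
  simp only [(hasSum_prod_theta_factors hh0 hq hz _).tsum_eq] at hlim
  rw [tendsto_nhds_unique hprod hlim, tsum_mul_left, mul_inv_cancel_left₀ hL0, thetaSeries]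

theorem tsum_eq_tsum_tsum_equiv {α β γ : Type*} {f : γ → ℂ} (hf : Summable f) (e : α × β ≃ γ) :
    ∑' c, f c = ∑' a, ∑' b, f (e (a, b)) :=
  (e.tsum_eq f).symm.trans (Summable.tsum_prod (e.summable_iff.mpr hf))

theorem tsum_int_trisect {f : ℤ → ℂ} (hf : Summable f) :
    ∑' n, f n = ∑' l, f (3 * l) + ∑' l, f (3 * l + 1) + ∑' l, f (3 * l + 2) := by
  have hinj (r : ℤ) : Function.Injective fun l : ℤ => 3 * l + r := fun a b hab => by
    simp only at hab
    omega
  have h0 : Summable fun l : ℤ => f (3 * l) := by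
    simpa [Function.comp_def] using hf.comp_injective (hinj 0)
  have h1 : Summable fun l : ℤ => f (3 * l + 1) := hf.comp_injective (hinj 1)
  have h2 : Summable fun l : ℤ => f (3 * l + 2) := hf.comp_injective (hinj 2)
  rw [← h0.tsum_add h1, ← (h0.add h1).tsum_add h2,
    tsum_eq_tsum_tsum_equiv hf (Int.divModEquiv 3).symm]
  refine tsum_congr fun l => ?_
  rw [tsum_fintype, Fin.sum_univ_three]
  simp [mul_comm l]

theorem quintuple_term_reindex {h y : ℂ} (hh0 : h ≠ 0) (hy : y ≠ 0) (l m r : ℤ) :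
    h ^ ((3 * l + r - 2 * (m + l)) * (3 * l + r - 2 * (m + l) - 1)) *
        (-y) ^ (3 * l + r - 2 * (m + l)) *
        ((h ^ 2) ^ ((m + l) * (m + l - 1)) * (-(h ^ 2 * y ^ 2)) ^ (m + l)) =
      h ^ (r * (r - 1)) * (-y) ^ r *
        ((h ^ 3) ^ (l * (l - 1)) * (h ^ (2 + 2 * r) * y ^ 3) ^ l) *
        ((h ^ 6) ^ (m * (m - 1)) * (-h ^ (8 - 4 * r)) ^ m) := by
  have hny : -y ≠ 0 := neg_ne_zero.mpr hy
  have e1 : -(h ^ 2 * y ^ 2) = -1 * (h ^ (2 : ℤ) * (-y) ^ (2 : ℤ)) := by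
    rw [zpow_ofNat, zpow_ofNat]; ring
  have e2 : y ^ 3 = -1 * (-y) ^ (3 : ℤ) := by rw [zpow_ofNat]; ring
  have e3 : -h ^ (8 - 4 * r) = -1 * h ^ (8 - 4 * r) := by ring
  rw [e1, e2, e3]
  generalize -y = w at *
  simp only [← zpow_natCast h, mul_zpow, ← zpow_mul]
  have s : (-1 : ℂ) ^ (m + l) = (-1) ^ l * (-1) ^ m := by
    rw [zpow_add₀ (by norm_num), mul_comm]
  have eh : h ^ ((3 * l + r - 2 * (m + l)) * (3 * l + r - 2 * (m + l) - 1)) *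
      h ^ (((2 : ℕ) : ℤ) * ((m + l) * (m + l - 1))) * h ^ (2 * (m + l)) =
      h ^ (r * (r - 1)) * h ^ (((3 : ℕ) : ℤ) * (l * (l - 1))) * h ^ ((2 + 2 * r) * l) *
      h ^ (((6 : ℕ) : ℤ) * (m * (m - 1))) * h ^ ((8 - 4 * r) * m) := by
    simp only [← zpow_add₀ hh0]
    congr 1; push_cast; ring
  have ew : w ^ (3 * l + r - 2 * (m + l)) * w ^ (2 * (m + l)) = w ^ r * w ^ (3 * l) := by
    simp only [← zpow_add₀ hny]
    congr 1; ring
  rw [s]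
  linear_combination (-1) ^ l * (-1) ^ m * w ^ (3 * l + r - 2 * (m + l)) * w ^ (2 * (m + l)) * eh
    + (-1) ^ l * (-1) ^ m * (h ^ (r * (r - 1)) * h ^ (((3 : ℕ) : ℤ) * (l * (l - 1))) *
      h ^ ((2 + 2 * r) * l) * h ^ (((6 : ℕ) : ℤ) * (m * (m - 1))) * h ^ ((8 - 4 * r) * m)) * ew

theorem qpoch_one (p : ℂ) : qpoch 1 p = 0 :=
  tprod_of_exists_eq_zero ⟨0, by simp⟩

theorem thetaSeries_mul_thetaSeries {h y : ℂ} (hh0 : h ≠ 0) (hh : ‖h‖ < 1) (hy : y ≠ 0) :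
    thetaSeries h (-y) * thetaSeries (h ^ 2) (-(h ^ 2 * y ^ 2)) =
      thetaSeries (h ^ 3) (h ^ 2 * y ^ 3) * thetaSeries (h ^ 6) (-h ^ 8)
        - y * thetaSeries (h ^ 3) (h ^ 4 * y ^ 3) * thetaSeries (h ^ 6) (-h ^ 4)
        + h ^ 2 * y ^ 2 * thetaSeries (h ^ 3) (h ^ 6 * y ^ 3) * thetaSeries (h ^ 6) (-1) := by
  have hh2 : ‖h ^ 2‖ < 1 := by
    rw [norm_pow]; exact pow_lt_one₀ (norm_nonneg h) hh two_ne_zero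
  have s1 := summable_zpow_mul_zpow hh0 hh (neg_ne_zero.mpr hy)
  have s2 := summable_zpow_mul_zpow (z := -(h ^ 2 * y ^ 2)) (pow_ne_zero 2 hh0) hh2
    (by simp [hh0, hy])
  have hFs := summable_mul_of_summable_norm s1.norm s2.norm
  let e : ℤ × ℤ ≃ ℤ × ℤ :=
    { toFun := fun x => (x.1 - 2 * x.2, x.2)
      invFun := fun x => (x.1 + 2 * x.2, x.2)
      left_inv := fun x => by simp
      right_inv := fun x => by simp }
  have hFe := e.summable_iff.mpr hFs
  have hrow (r : ℤ) : ∑' l : ℤ, ∑' m : ℤ,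
      (h ^ ((3 * l + r - 2 * m) * (3 * l + r - 2 * m - 1)) * (-y) ^ (3 * l + r - 2 * m) *
        ((h ^ 2) ^ (m * (m - 1)) * (-(h ^ 2 * y ^ 2)) ^ m)) =
      h ^ (r * (r - 1)) * (-y) ^ r * thetaSeries (h ^ 3) (h ^ (2 + 2 * r) * y ^ 3) *
        thetaSeries (h ^ 6) (-h ^ (8 - 4 * r)) := by
    rw [thetaSeries, ← tsum_mul_left, ← tsum_mul_right]
    refine tsum_congr fun l => ?_
    rw [thetaSeries, ← tsum_mul_left, ← (Equiv.addRight l).tsum_eq]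
    exact tsum_congr fun m => quintuple_term_reindex hh0 hy l m r
  have h0 := hrow 0
  have h1 := hrow 1
  have h2 := hrow 2
  simp only [add_zero] at h0
  rw [thetaSeries, thetaSeries, s1.tsum_mul_tsum s2 hFs]
  refine ((tsum_eq_tsum_tsum_equiv hFs e).trans (tsum_int_trisect hFe.prod)).trans ?_
  refine (congrArg₂ (· + ·) (congrArg₂ (· + ·) h0 h1) h2).trans ?_
  norm_num [zpow_ofNat]
  ring

/-- The quintuple product identity. -/
theorem theta_quintuple {h y : ℂ} (hh0 : h ≠ 0) (hh : ‖h‖ < 1) (hy : y ≠ 0) :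
    qpoch (h ^ 2) (h ^ 2) * (theta y (h ^ 2) * theta (h ^ 2 * y ^ 2) (h ^ 4)) =
      qpoch (h ^ 6) (h ^ 6) *
        (theta (-(h ^ 2 * y ^ 3)) (h ^ 6) - y * theta (-(h ^ 4 * y ^ 3)) (h ^ 6)) := by
  have hpow (n : ℕ) (hn : n ≠ 0) : ‖h ^ n‖ < 1 := by
    rw [norm_pow]; exact pow_lt_one₀ (norm_nonneg h) hh hn
  have hjac (n : ℕ) (hn : n ≠ 0) {z : ℂ} (hz : z ≠ 0) :
      thetaSeries (h ^ n) z = qpoch (h ^ (n * 2)) (h ^ (n * 2)) * theta (-z) (h ^ (n * 2)) := by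
    rw [pow_mul, qpoch_mul_theta_neg (pow_ne_zero n hh0) (hpow n hn) hz]
  have hj1 := hjac 1 one_ne_zero (neg_ne_zero.mpr hy)
  rw [pow_one] at hj1
  have hconst : qpoch (h ^ 4) (h ^ 4) =
      qpoch (h ^ 12) (h ^ 12) * (qpoch (h ^ 4) (h ^ 12) * qpoch (h ^ 8) (h ^ 12)) := by
    have := qpoch_trisect (h ^ 4) (hpow 4 (by norm_num))
    simp only [← pow_mul, ← pow_add] at this
    rw [this]; ring
  have d8 : h ^ 12 / h ^ 8 = h ^ 4 := by field_simp
  have d4 : h ^ 12 / h ^ 4 = h ^ 8 := by field_simp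
  have hB0 : thetaSeries (h ^ 6) (-h ^ 8) = qpoch (h ^ 4) (h ^ 4) := by
    rw [hjac 6 (by norm_num) (by simp [hh0]), hconst]
    simp only [neg_neg, theta, Nat.reduceMul, d8]
    ring
  have hB1 : thetaSeries (h ^ 6) (-h ^ 4) = qpoch (h ^ 4) (h ^ 4) := by
    rw [hjac 6 (by norm_num) (by simp [hh0]), hconst]
    simp only [neg_neg, theta, Nat.reduceMul, d4]
  have hB2 : thetaSeries (h ^ 6) (-1) = 0 := by
    rw [hjac 6 (by norm_num) (by simp), neg_neg, theta, qpoch_one, zero_mul, mul_zero]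
  have hprod := thetaSeries_mul_thetaSeries hh0 hh hy
  rw [hB0, hB1, hB2, hj1, hjac 2 two_ne_zero (by simp [hh0, hy]),
    hjac 3 (by norm_num) (by simp [hh0, hy]), hjac 3 (by norm_num) (by simp [hh0, hy]),
    neg_neg, neg_neg] at hprod
  have h4 : qpoch (h ^ 4) (h ^ 4) ≠ 0 := qpoch_self_ne_zero (hpow 4 (by norm_num))
  refine mul_left_cancel₀ h4 ?_
  linear_combination hprod

theorem cube_eq_one_theta_sub {u y w : ℂ} (hu0 : u ≠ 0) (hu : ‖u‖ < 1) (hy : y ≠ 0)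
    (hw : w ^ 3 = 1) :
    qpoch (u ^ 2) (u ^ 2) * (theta (-(w * y)) (u ^ 2) - w * theta (-(w ^ 2 * y)) (u ^ 2)) =
      (1 - w) * (qpoch (u ^ 18) (u ^ 18) *
        (theta (-(u ^ 6 * y ^ 3)) (u ^ 18) - y * theta (-(u ^ 12 * y ^ 3)) (u ^ 18))) := by
  have hw0 : w ≠ 0 := by rintro rfl; norm_num at hw
  have h9 : ‖u ^ 9‖ < 1 := by
    rw [norm_pow]; exact pow_lt_one₀ (norm_nonneg u) hu (by norm_num)
  have hw1 : w * y ≠ 0 := mul_ne_zero hw0 hy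
  have hw2 : w ^ 2 * y ≠ 0 := mul_ne_zero (pow_ne_zero 2 hw0) hy
  have s1 := summable_zpow_mul_zpow hu0 hu hw1
  have s2 := (summable_zpow_mul_zpow hu0 hu hw2).mul_left w
  have j0 := qpoch_mul_theta_neg (pow_ne_zero 9 hu0) h9 (z := u ^ 6 * y ^ 3) (by simp [hu0, hy])
  have j1 := qpoch_mul_theta_neg (pow_ne_zero 9 hu0) h9 (z := u ^ 12 * y ^ 3) (by simp [hu0, hy])
  rw [← pow_mul] at j0 j1
  have hwl (l : ℤ) : w ^ (3 * l) = 1 := by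
    rw [zpow_mul, show w ^ (3 : ℤ) = 1 by exact_mod_cast hw, one_zpow]
  have hwl2 (l : ℤ) : (w ^ 2) ^ (3 * l) = 1 := by
    rw [← zpow_natCast w 2, ← zpow_mul, mul_comm, zpow_mul, hwl, one_zpow]
  rw [mul_sub, mul_left_comm, qpoch_mul_theta_neg hu0 hu hw1, qpoch_mul_theta_neg hu0 hu hw2,
    thetaSeries, thetaSeries,
    ← tsum_mul_left, ← s1.tsum_sub s2, tsum_int_trisect (s1.sub s2), mul_sub,
    mul_left_comm _ y, j0, j1, thetaSeries, thetaSeries, mul_sub,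
    ← tsum_mul_left, ← tsum_mul_left, ← tsum_mul_left]
  have t0 (l : ℤ) : u ^ (3 * l * (3 * l - 1)) * y ^ (3 * l) =
      (u ^ 9) ^ (l * (l - 1)) * (u ^ 6 * y ^ 3) ^ l := by
    rw [mul_zpow, ← zpow_natCast u, ← zpow_natCast u, ← zpow_natCast y, ← zpow_mul, ← zpow_mul,
      ← zpow_mul, ← mul_assoc, ← zpow_add₀ hu0]
    congr 2; push_cast; ring
  have t1 (l : ℤ) : u ^ ((3 * l + 1) * (3 * l + 1 - 1)) * y ^ (3 * l) =
      (u ^ 9) ^ (l * (l - 1)) * (u ^ 12 * y ^ 3) ^ l := by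
    rw [mul_zpow, ← zpow_natCast u, ← zpow_natCast u, ← zpow_natCast y, ← zpow_mul, ← zpow_mul,
      ← zpow_mul, ← mul_assoc, ← zpow_add₀ hu0]
    congr 2; push_cast; ring
  have hw20 : w ^ 2 ≠ 0 := pow_ne_zero 2 hw0
  have e0 : ∑' l : ℤ, (u ^ (3 * l * (3 * l - 1)) * (w * y) ^ (3 * l) -
      w * (u ^ (3 * l * (3 * l - 1)) * (w ^ 2 * y) ^ (3 * l))) =
      ∑' l : ℤ, (1 - w) * ((u ^ 9) ^ (l * (l - 1)) * (u ^ 6 * y ^ 3) ^ l) :=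
    tsum_congr fun l => by
      rw [← t0, mul_zpow, mul_zpow, hwl, hwl2]; ring
  have e1 : ∑' l : ℤ, (u ^ ((3 * l + 1) * (3 * l + 1 - 1)) * (w * y) ^ (3 * l + 1) -
      w * (u ^ ((3 * l + 1) * (3 * l + 1 - 1)) * (w ^ 2 * y) ^ (3 * l + 1))) =
      -∑' l : ℤ, (1 - w) * (y * ((u ^ 9) ^ (l * (l - 1)) * (u ^ 12 * y ^ 3) ^ l)) := by
    rw [← tsum_neg]
    refine tsum_congr fun l => ?_
    rw [← t1, mul_zpow, mul_zpow, zpow_add_one₀ hw0, zpow_add_one₀ hw20, zpow_add_one₀ hy, hwl,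
      hwl2]
    linear_combination (-(u ^ ((3 * l + 1) * (3 * l + 1 - 1)) * y ^ (3 * l) * y)) * hw
  have e2 : ∑' l : ℤ, (u ^ ((3 * l + 2) * (3 * l + 2 - 1)) * (w * y) ^ (3 * l + 2) -
      w * (u ^ ((3 * l + 2) * (3 * l + 2 - 1)) * (w ^ 2 * y) ^ (3 * l + 2))) = 0 := by
    rw [← tsum_zero (α := ℂ) (β := ℤ)]
    refine tsum_congr fun l => ?_
    rw [mul_zpow, mul_zpow, zpow_add₀ hw0, zpow_add₀ hw20, hwl, hwl2]
    norm_cast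
    linear_combination (-(u ^ ((3 * l + 2) * (3 * l + 2 - 1)) * y ^ (3 * l + 2) * w ^ 2)) * hw
  rw [e0, e1, e2]
  simp only [tsum_mul_left]
  ring

theorem pPow_eq_pow {τ a b : ℂ} (n : ℕ) (h : b = n * a) : pPow τ b = pPow τ a ^ n := by
  rw [pPow, pPow, ← exp_nat_mul, h]
  congr 1; ring

theorem norm_pPow_lt_one {τ : ℂ} (hτ : 0 < τ.im) {a : ℝ} (ha : 0 < a) : ‖pPow τ a‖ < 1 := by
  rw [pPow, norm_exp, Real.exp_lt_one_iff]
  simp only [mul_re, mul_im, ofReal_re, ofReal_im, I_re, I_im]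
  have := mul_pos (mul_pos Real.pi_pos hτ) ha
  ring_nf
  linarith

theorem isPrimitiveRoot_omg : IsPrimitiveRoot omg 3 := by
  simpa [omg] using Complex.isPrimitiveRoot_exp 3 (by norm_num)

/-- The quintuple product in the form of a product of three theta functions of the same nome. -/
theorem theta_mul_theta_mul_theta {u y : ℂ} (hu0 : u ≠ 0) (hu : ‖u‖ < 1) (hy : y ≠ 0) :
    qpoch (u ^ 6) (u ^ 6) *
        (theta y (u ^ 6) * theta (u ^ 3 * y) (u ^ 6) * theta (-(u ^ 3 * y)) (u ^ 6)) =
      qpoch (u ^ 18) (u ^ 18) *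
        (theta (-(u ^ 6 * y ^ 3)) (u ^ 18) - y * theta (-(u ^ 12 * y ^ 3)) (u ^ 18)) := by
  have hpow (n : ℕ) (hn : n ≠ 0) : ‖u ^ n‖ < 1 := by
    rw [norm_pow]; exact pow_lt_one₀ (norm_nonneg u) hu hn
  have := theta_quintuple (pow_ne_zero 3 hu0) (hpow 3 (by norm_num)) hy
  have h2 := theta_mul_theta_neg (u ^ 3 * y) (hpow 6 (by norm_num))
  simp only [← pow_mul, mul_pow, Nat.reduceMul] at this h2
  rw [mul_assoc (theta y _), h2, this]

theorem stmt2 (τ : ℂ) (hτ : 0 < τ.im) :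
    ∀ x : ℂ, x ≠ 0 →
      (x ^ (-1 : ℤ) * (theta (x ^ 2) (pPow τ 2) * theta (pPow τ 1 * x ^ 2) (pPow τ 2) *
          theta (-(pPow τ 1 * x ^ 2)) (pPow τ 2)) =
        qpoch (pPow τ 6) (pPow τ 6) / qpoch (pPow τ 2) (pPow τ 2) *
          (x ^ (-1 : ℤ) * theta (-(pPow τ 2 * x ^ 6)) (pPow τ 6) -
            x * theta (-(pPow τ 4 * x ^ 6)) (pPow τ 6))) ∧
      (x ^ (-1 : ℤ) * (theta (x ^ 2) (pPow τ 2) * theta (pPow τ 1 * x ^ 2) (pPow τ 2) *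
          theta (-(pPow τ 1 * x ^ 2)) (pPow τ 2)) =
        qpoch (pPow τ (2/3)) (pPow τ (2/3)) / ((1 - omg) * qpoch (pPow τ 2) (pPow τ 2)) *
          (x ^ (-1 : ℤ) * (theta (-(omg * x ^ 2)) (pPow τ (2/3)) -
            omg * theta (-(omg ^ 2 * x ^ 2)) (pPow τ (2/3))))) ∧
      (x ^ (-2 : ℤ) * (theta (x ^ 2) (pPow τ 2) * theta (-x ^ 2) (pPow τ 2) *
          theta (pPow τ 1 * x ^ 2) (pPow τ 2)) =
        qpoch (pPow τ 6) (pPow τ 6) / qpoch (pPow τ 2) (pPow τ 2) *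
          (x ^ (-2 : ℤ) * theta (-(pPow τ 1 * x ^ 6)) (pPow τ 6) -
            x ^ 2 * theta (-(pPow τ 5 * x ^ 6)) (pPow τ 6))) ∧
      (x ^ (-2 : ℤ) * (theta (x ^ 2) (pPow τ 2) * theta (-x ^ 2) (pPow τ 2) *
          theta (pPow τ 1 * x ^ 2) (pPow τ 2)) =
        pPow τ (-(1/3)) * qpoch (pPow τ (2/3)) (pPow τ (2/3)) /
            ((omg - omg ^ 2) * qpoch (pPow τ 2) (pPow τ 2)) *
          (theta (-(omg ^ 2 * pPow τ (1/3) * x ^ 2)) (pPow τ (2/3)) -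
            theta (-(omg * pPow τ (1/3) * x ^ 2)) (pPow τ (2/3)))) := by
  intro x hx
  set u := pPow τ (1 / 3) with hu
  have hu0 : u ≠ 0 := exp_ne_zero _
  have hu1 : ‖u‖ < 1 := by
    have := norm_pPow_lt_one hτ (a := 1 / 3) (by norm_num)
    push_cast at this
    exact this
  have hpow (n : ℕ) (hn : n ≠ 0) : ‖u ^ n‖ < 1 := by
    rw [norm_pow]; exact pow_lt_one₀ (norm_nonneg u) hu1 hn
  have p1 : pPow τ 1 = u ^ 3 := pPow_eq_pow 3 (by norm_num)
  have p2 : pPow τ 2 = u ^ 6 := pPow_eq_pow 6 (by norm_num)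
  have p4 : pPow τ 4 = u ^ 12 := pPow_eq_pow 12 (by norm_num)
  have p5 : pPow τ 5 = u ^ 15 := pPow_eq_pow 15 (by norm_num)
  have p6 : pPow τ 6 = u ^ 18 := pPow_eq_pow 18 (by norm_num)
  have p23 : pPow τ (2 / 3) = u ^ 2 := pPow_eq_pow 2 (by norm_num)
  have pm : pPow τ (-(1 / 3)) = u⁻¹ := by
    rw [hu, pPow, pPow, ← exp_neg]; congr 1; ring
  rw [p1, p2, p4, p5, p6, p23, pm]
  have hw3 : omg ^ 3 = 1 := isPrimitiveRoot_omg.pow_eq_one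
  have hw1 : 1 - omg ≠ 0 := sub_ne_zero.mpr (isPrimitiveRoot_omg.ne_one (by norm_num)).symm
  have hw0 : omg ≠ 0 := exp_ne_zero _
  generalize omg = w at hw3 hw1 hw0 ⊢
  have hw2 : w - w ^ 2 ≠ 0 := by
    rw [show w - w ^ 2 = w * (1 - w) by ring]; exact mul_ne_zero hw0 hw1
  have hQ : qpoch (u ^ 6) (u ^ 6) ≠ 0 := qpoch_self_ne_zero (hpow 6 (by norm_num))
  have hx2 : x ^ 2 ≠ 0 := pow_ne_zero 2 hx
  have hux : u ^ 3 * x ^ 2 ≠ 0 := mul_ne_zero (pow_ne_zero 3 hu0) hx2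
  have a1 := theta_mul_theta_mul_theta hu0 hu1 hx2
  have b1 := cube_eq_one_theta_sub hu0 hu1 hx2 hw3
  have a2 := theta_mul_theta_mul_theta hu0 hu1 hux
  have b2 := cube_eq_one_theta_sub hu0 hu1 hux hw3
  rw [← a1] at b1
  rw [← a2] at b2
  have f1 := theta_mul_self hx2 (pow_ne_zero 6 hu0) (hpow 6 (by norm_num))
  have f2 := theta_mul_self (neg_ne_zero.mpr hx2) (pow_ne_zero 6 hu0) (hpow 6 (by norm_num))
  have f3 := theta_mul_self (z := -(u ^ 3 * x ^ 6)) (by simp [hu0, hx]) (pow_ne_zero 18 hu0)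
    (hpow 18 (by norm_num))
  have f4 := theta_mul_self (z := -(w * u * x ^ 2)) (by simp [hu0, hx, hw0]) (pow_ne_zero 2 hu0)
    (hpow 2 (by norm_num))
  have f5 := theta_mul_self (z := -(w ^ 2 * u * x ^ 2)) (by simp [hu0, hx, hw0])
    (pow_ne_zero 2 hu0) (hpow 2 (by norm_num))
  rw [show u ^ 3 * (u ^ 3 * x ^ 2) = u ^ 6 * x ^ 2 by ring, f1,
    show -(u ^ 6 * x ^ 2) = u ^ 6 * -x ^ 2 by ring, f2] at a2 b2
  rw [show -(u ^ 6 * (u ^ 3 * x ^ 2) ^ 3) = -(u ^ 15 * x ^ 6) by ring,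
    show -(u ^ 12 * (u ^ 3 * x ^ 2) ^ 3) = u ^ 18 * -(u ^ 3 * x ^ 6) by ring, f3] at a2
  rw [show -(w * (u ^ 3 * x ^ 2)) = u ^ 2 * -(w * u * x ^ 2) by ring, f4,
    show -(w ^ 2 * (u ^ 3 * x ^ 2)) = u ^ 2 * -(w ^ 2 * u * x ^ 2) by ring, f5] at b2
  rw [← pow_mul, show 2 * 3 = 6 from rfl] at a1
  simp only [zpow_neg, zpow_ofNat]
  clear f1 f2 f3 f4 f5
  generalize theta (x ^ 2) (u ^ 6) = T₁ at a1 b1 a2 b2 ⊢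
  generalize theta (-x ^ 2) (u ^ 6) = T₂ at a1 b1 a2 b2 ⊢
  generalize theta (u ^ 3 * x ^ 2) (u ^ 6) = T₃ at a1 b1 a2 b2 ⊢
  generalize theta (-(u ^ 3 * x ^ 2)) (u ^ 6) = T₄ at a1 b1 a2 b2 ⊢
  generalize theta (-(u ^ 6 * x ^ 6)) (u ^ 18) = A₁ at a1 b1 a2 b2 ⊢
  generalize theta (-(u ^ 12 * x ^ 6)) (u ^ 18) = A₂ at a1 b1 a2 b2 ⊢
  generalize theta (-(u ^ 3 * x ^ 6)) (u ^ 18) = A₃ at a1 b1 a2 b2 ⊢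
  generalize theta (-(u ^ 15 * x ^ 6)) (u ^ 18) = A₄ at a1 b1 a2 b2 ⊢
  generalize theta (-(w * x ^ 2)) (u ^ 2) = B₁ at a1 b1 a2 b2 ⊢
  generalize theta (-(w ^ 2 * x ^ 2)) (u ^ 2) = B₂ at a1 b1 a2 b2 ⊢
  generalize theta (-(w * u * x ^ 2)) (u ^ 2) = B₃ at a1 b1 a2 b2 ⊢
  generalize theta (-(w ^ 2 * u * x ^ 2)) (u ^ 2) = B₄ at a1 b1 a2 b2 ⊢
  refine ⟨?_, ?_, ?_, ?_⟩
  · field_simp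
    linear_combination a1
  · field_simp
    linear_combination -b1
  · field_simp
    field_simp at a2
    linear_combination -a2
  · field_simp
    field_simp at b2
    linear_combination b2

end
end
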